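/- Let 𝒢 be an ample groupoid and k ≥ 1 a natural number. Then the set O_k of all x ∈ 𝒢⁰ whose orbit has at least k elements is an open invariant subset of 𝒢⁰. -/

import Mathlib

universe u

/-- The algebraic operations of a groupoid (identified with its set of arrows):
a (partially meaningful) composition `gmul` and an inversion `ginv`.  The product
`gmul g h` is only required to behave like composition when `g` and `h` are
composable, i.e. when `src g = rng h`. -/
class GroupoidOps (G : Type u) where
  gmul : G → G → G
  ginv : G → G

namespace GroupoidOps

variable {G : Type u} [GroupoidOps G]

/-- The source map `s g = g⁻¹ g`. -/
def src (g : G) : G := gmul (ginv g) g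

/-- The range map `r g = g g⁻¹`. -/
def rng (g : G) : G := gmul g (ginv g)

/-- The unit space `𝒢⁰`: the set of identity arrows. -/
def unitSpace (G : Type u) [GroupoidOps G] : Set G := {x : G | src x = x}

end GroupoidOps

open GroupoidOps

/-- A topological groupoid: a groupoid `G`, identified with its arrow space, equipped
with a topology such that inversion is continuous and composition is continuous on the
set of composable pairs. -/
class TopologicalGroupoid (G : Type u) extends TopologicalSpace G, GroupoidOps G where
  ginv_ginv : ∀ g : G, ginv (ginv g) = g
  gmul_src : ∀ g : G, gmul g (src g) = g
  rng_gmul : ∀ g : G, gmul (rng g) g = g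
  gmul_assoc : ∀ g h k : G, src g = rng h → src h = rng k →
    gmul (gmul g h) k = gmul g (gmul h k)
  src_gmul : ∀ g h : G, src g = rng h → src (gmul g h) = src h
  rng_gmul_comp : ∀ g h : G, src g = rng h → rng (gmul g h) = rng g
  ginv_gmul : ∀ g h : G, src g = rng h → ginv (gmul g h) = gmul (ginv h) (ginv g)
  ginv_unit : ∀ x : G, src x = x → ginv x = x
  src_src : ∀ g : G, src (src g) = src g
  src_rng : ∀ g : G, src (rng g) = rng g
  continuous_ginv : Continuous (ginv : G → G)
  continuous_gmul : Continuous fun p : {p : G × G // src p.1 = rng p.2} => gmul p.1.1 p.1.2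

/-- An ample groupoid: a topological groupoid (not necessarily Hausdorff) whose unit
space is locally compact, Hausdorff and totally disconnected in the subspace topology,
and whose source map, viewed as a map `G → 𝒢⁰`, is a local homeomorphism. -/
class AmpleGroupoid (G : Type u) extends TopologicalGroupoid G where
  t2_unitSpace : T2Space (unitSpace G)
  locallyCompact_unitSpace : LocallyCompactSpace (unitSpace G)
  totallyDisconnected_unitSpace : TotallyDisconnectedSpace (unitSpace G)
  isLocalHomeomorph_src :
    IsLocalHomeomorph fun g : G => (⟨src g, TopologicalGroupoid.src_src g⟩ : unitSpace G)

namespace TopologicalGroupoid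

variable {G : Type u} [TopologicalGroupoid G]

/-- A bisection: an open subset on which both the source and the range map are injective. -/
def IsBisection (U : Set G) : Prop :=
  IsOpen U ∧ Set.InjOn (src : G → G) U ∧ Set.InjOn (rng : G → G) U

/-- A compact bisection: a bisection which is compact
(quasi-compact and Hausdorff in the subspace topology). -/
def IsCompactBisection (U : Set G) : Prop :=
  IsBisection U ∧ IsCompact U ∧ T2Space U

/-- Setwise inverse `U⁻¹ = { u⁻¹ : u ∈ U }`. -/
def setInv (U : Set G) : Set G := ginv '' U

/-- Setwise product `UV = { uv : u ∈ U, v ∈ V, s(u) = r(v) }`. -/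
def setMul (U V : Set G) : Set G :=
  {x : G | ∃ u ∈ U, ∃ v ∈ V, src u = rng v ∧ x = gmul u v}

/-- A subgroupoid: a subset closed under inversion and (composable) composition. -/
def IsSubgroupoid (H : Set G) : Prop :=
  (∀ g ∈ H, ginv g ∈ H) ∧ ∀ g ∈ H, ∀ h ∈ H, src g = rng h → gmul g h ∈ H

/-- A groupoid is principal if every isotropy element is a unit. -/
def IsPrincipal (G : Type u) [TopologicalGroupoid G] : Prop :=
  ∀ g : G, src g = rng g → g ∈ unitSpace G

/-- The orbit of `x`, namely `r(s⁻¹(x))`. -/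
def orbit (x : G) : Set G := {y : G | ∃ g : G, src g = x ∧ rng g = y}

/-- A subset of the unit space is invariant if it is a union of orbits. -/
def IsInvariant (U : Set G) : Prop := ∀ g : G, src g ∈ U → rng g ∈ U

/-- An inverse semigroup of compact bisections: a nonempty collection of compact
bisections closed under setwise product and setwise inverse. -/
def IsInvSemigroupOfCompactBisections (S : Set (Set G)) : Prop :=
  S.Nonempty ∧ (∀ U ∈ S, IsCompactBisection U) ∧
    (∀ U ∈ S, setInv U ∈ S) ∧ ∀ U ∈ S, ∀ V ∈ S, setMul U V ∈ S

/-- The orbit equivalence relation `𝓡` on the unit space. -/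
def orbitRel (G : Type u) [TopologicalGroupoid G] :
    unitSpace G → unitSpace G → Prop :=
  fun x y => ∃ g : G, src g = (x : G) ∧ rng g = (y : G)

end TopologicalGroupoid

open TopologicalGroupoid

/-- If `s` is an open map and `r` is a continuous map to a Hausdorff space, then the set of points
`x` for which `r` takes at least `k` values on the fibre of `s` over `x` is open. -/
theorem isOpen_setOf_le_card_image_fiber {X Y Z : Type*} [TopologicalSpace X]
    [TopologicalSpace Y] [TopologicalSpace Z] [T2Space Z] {s : X → Y} {r : X → Z}
    (hs : IsOpenMap s) (hr : Continuous r) (k : ℕ) :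
    IsOpen {x : Y | ∃ t : Finset Z, ↑t ⊆ r '' (s ⁻¹' {x}) ∧ k ≤ t.card} := by
  classical
  rw [isOpen_iff_forall_mem_open]
  rintro x ⟨t, ht, hk⟩
  obtain ⟨U, hU, hdisj⟩ := t.finite_toSet.t2_separation
  refine ⟨⋂ y ∈ t, s '' (r ⁻¹' U y), ?_, ?_, ?_⟩
  · intro x' hx'
    simp only [Set.mem_iInter] at hx'
    choose g hgU hgs using fun y : t => hx' y y.2
    refine ⟨t.attach.image (r ∘ g), ?_, ?_⟩
    · intro z hz
      obtain ⟨y, -, rfl⟩ := Finset.mem_image.1 hz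
      exact ⟨g y, hgs y, rfl⟩
    · rwa [Finset.card_image_of_injective, Finset.card_attach]
      intro y z hyz
      by_contra hne
      refine Set.disjoint_left.1 (hdisj y.2 z.2 (Subtype.coe_injective.ne hne)) (hgU y) ?_
      simp only [Function.comp_apply] at hyz
      rw [hyz]
      exact hgU z
  · exact isOpen_biInter_finset fun y _ => hs _ ((hU y).2.preimage hr)
  · simp only [Set.mem_iInter]
    intro y hy
    obtain ⟨g, hg, hgy⟩ := ht hy
    exact ⟨g, by simpa [hgy] using (hU y).1, hg⟩

namespace TopologicalGroupoid

variable {G : Type u} [TopologicalGroupoid G]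

theorem src_ginv (g : G) : src (ginv g) = rng g := by
  simp only [src, rng, ginv_ginv]

theorem rng_ginv (g : G) : rng (ginv g) = src g := by
  simp only [src, rng, ginv_ginv]

theorem orbit_src_subset_orbit_rng (g : G) : orbit (src g) ⊆ orbit (rng g) := by
  rintro y ⟨h, hs, hr⟩
  have hc : src h = rng (ginv g) := hs.trans (rng_ginv g).symm
  exact ⟨gmul h (ginv g), (src_gmul h _ hc).trans (src_ginv g), (rng_gmul_comp h _ hc).trans hr⟩

theorem continuous_rng_of_continuous_src
    (h : Continuous fun g : G => (⟨src g, src_src g⟩ : unitSpace G)) :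
    Continuous fun g : G => (⟨rng g, src_rng g⟩ : unitSpace G) := by
  simpa only [Function.comp_def, src_ginv] using h.comp continuous_ginv

/-- Finite subsets of an orbit may be taken inside `G` or inside the unit space. -/
theorem exists_finset_subset_orbit_iff (x : unitSpace G) (k : ℕ) :
    (∃ t : Finset G, ↑t ⊆ orbit (x : G) ∧ k ≤ t.card) ↔
      ∃ t : Finset (unitSpace G), ↑t ⊆ (fun g : G => (⟨rng g, src_rng g⟩ : unitSpace G)) ''
        ((fun g : G => (⟨src g, src_src g⟩ : unitSpace G)) ⁻¹' {x}) ∧ k ≤ t.card := by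
  classical
  constructor
  · rintro ⟨t, ht, hk⟩
    refine ⟨t.subtype (· ∈ unitSpace G), ?_, ?_⟩
    · intro y hy
      obtain ⟨g, hs, hr⟩ := ht (Finset.mem_subtype.1 hy)
      exact ⟨g, Subtype.ext hs, Subtype.ext hr⟩
    · rwa [Finset.card_subtype, Finset.filter_true_of_mem]
      intro y hy
      obtain ⟨g, -, rfl⟩ := ht hy
      exact src_rng g
  · rintro ⟨t, ht, hk⟩
    refine ⟨t.map (Function.Embedding.subtype _), ?_, by rwa [Finset.card_map]⟩
    intro y hy
    obtain ⟨z, hz, rfl⟩ := Finset.mem_map.1 hy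
    obtain ⟨g, hs, hr⟩ := ht hz
    exact ⟨g, congrArg Subtype.val hs, congrArg Subtype.val hr⟩

end TopologicalGroupoid

/-- For an ample groupoid `𝒢` and `k ≥ 1`, the set `O_k` of units
whose orbit has at least `k` elements is an open (in `𝒢⁰`) invariant subset of
`𝒢⁰`. -/
theorem O_k_open_invariant (G : Type u) [AmpleGroupoid G] (k : ℕ) (hk : 1 ≤ k) :
    IsOpen (Subtype.val ⁻¹'
        {x : G | x ∈ unitSpace G ∧ ∃ t : Finset G, ↑t ⊆ orbit x ∧ k ≤ t.card} :
      Set (unitSpace G)) ∧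
    IsInvariant {x : G | x ∈ unitSpace G ∧ ∃ t : Finset G, ↑t ⊆ orbit x ∧ k ≤ t.card} := by
  constructor
  · have : T2Space (unitSpace G) := AmpleGroupoid.t2_unitSpace
    have hs := AmpleGroupoid.isLocalHomeomorph_src (G := G)
    convert isOpen_setOf_le_card_image_fiber hs.isOpenMap
      (continuous_rng_of_continuous_src hs.continuous) k using 1
    ext x
    exact (and_iff_right x.2).trans (exists_finset_subset_orbit_iff x k)
  · rintro g ⟨-, t, ht, hk⟩
    exact ⟨src_rng g, t, ht.trans (orbit_src_subset_orbit_rng g), hk⟩
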